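/- arXiv:1611.02993 — 2 statements merged into one kernel-verified Lean document; each statement's English description precedes it below -/
import Mathlib

section
/- Let A₀ : D(A₀) ⊆ H₀ → H₁ and A₁ : D(A₁) ⊆ H₁ → H₂ be densely defined closed linear operators between Hilbert spaces satisfying R(A₀) ⊆ N(A₁), and set K := N(A₁) ∩ N(A₀*). Then the intersection domain D := D(A₁) ∩ D(A₀*) admits the orthogonal decomposition D = (D(A₀*) ∩ closure(R(A₀))) ⊕ K ⊕ (D(A₁) ∩ closure(R(A₁*))), orthogonal in H₁; in particular every x ∈ D(A₁) ∩ D(A₀*) splits as x = a* + κ + a with a* ∈ D(A₀*) ∩ closure(R(A₀)), κ ∈ K, a ∈ D(A₁) ∩ closure(R(A₁*)), A₁x = A₁a and A₀*x = A₀*a*. -/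
open Submodule LinearPMap RealInnerProductSpace

noncomputable section

/-- The range of a partially defined linear operator, as a submodule. -/
def pRan {E F : Type*} [AddCommGroup E] [Module ℝ E] [AddCommGroup F] [Module ℝ F]
    (A : E →ₗ.[ℝ] F) : Submodule ℝ F :=
  LinearMap.range A.toFun

/-- The kernel of a partially defined linear operator, as a submodule of the ambient space. -/
def pKer {E F : Type*} [AddCommGroup E] [Module ℝ E] [AddCommGroup F] [Module ℝ F]
    (A : E →ₗ.[ℝ] F) : Submodule ℝ E :=
  (LinearMap.ker A.toFun).map A.domain.subtype

variable {H₀ H₁ H₂ : Type*}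
  [NormedAddCommGroup H₀] [InnerProductSpace ℝ H₀] [CompleteSpace H₀]
  [NormedAddCommGroup H₁] [InnerProductSpace ℝ H₁] [CompleteSpace H₁]
  [NormedAddCommGroup H₂] [InnerProductSpace ℝ H₂] [CompleteSpace H₂]

section KernelRange

variable {E F : Type*}

lemma mem_pKer_iff [AddCommGroup E] [Module ℝ E] [AddCommGroup F] [Module ℝ F]
    {A : E →ₗ.[ℝ] F} {x : E} : x ∈ pKer A ↔ ∃ h : x ∈ A.domain, A ⟨x, h⟩ = 0 := by
  simp [pKer]

lemma mem_pKer_iff_mem_graph [AddCommGroup E] [Module ℝ E] [AddCommGroup F] [Module ℝ F]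
    {A : E →ₗ.[ℝ] F} {x : E} : x ∈ pKer A ↔ (x, (0 : F)) ∈ A.graph := by
  simp [mem_pKer_iff, LinearPMap.mem_graph_iff]

/-- Subtracting a kernel element stays in the domain and does not change the value. -/
lemma exists_map_eq_of_sub_mem_pKer [AddCommGroup E] [Module ℝ E] [AddCommGroup F] [Module ℝ F]
    {A : E →ₗ.[ℝ] F} {x y : E} (hx : x ∈ A.domain) (h : x - y ∈ pKer A) :
    ∃ hy : y ∈ A.domain, A ⟨x, hx⟩ = A ⟨y, hy⟩ := by
  obtain ⟨hd, h0⟩ := mem_pKer_iff.1 h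
  have hy : y ∈ A.domain := by simpa using A.domain.sub_mem hx hd
  refine ⟨hy, sub_eq_zero.1 ?_⟩
  rw [← LinearPMap.map_sub]
  exact h0

variable [NormedAddCommGroup E] [InnerProductSpace ℝ E] [CompleteSpace E]
  [NormedAddCommGroup F] [InnerProductSpace ℝ F]

/-- The kernel of the adjoint is the orthogonal complement of the range. -/
lemma pKer_adjoint {A : E →ₗ.[ℝ] F} (hA : Dense (A.domain : Set E)) :
    pKer (A†) = (pRan A)ᗮ := by
  ext y
  rw [mem_pKer_iff, Submodule.mem_orthogonal']
  constructor
  · rintro ⟨hy, h0⟩ _ ⟨x, rfl⟩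
    have := LinearPMap.adjoint_isFormalAdjoint hA ⟨y, hy⟩ x
    rw [h0, inner_zero_left] at this
    exact this.symm
  · intro h
    have h' : ∀ x : A.domain, ⟪(0 : E), (x : E)⟫ = ⟪y, A x⟫ := fun x => by
      rw [inner_zero_left]
      exact (h _ ⟨x, rfl⟩).symm
    have hy := LinearPMap.mem_adjoint_domain_of_exists y ⟨0, h'⟩
    exact ⟨hy, LinearPMap.adjoint_apply_eq hA ⟨y, hy⟩ h'⟩

/-- The kernel of a closed operator is the orthogonal complement of the range of its adjoint. -/
lemma pKer_eq_orthogonal_pRan_adjoint [CompleteSpace F] {A : E →ₗ.[ℝ] F}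
    (hA : Dense (A.domain : Set E)) (hc : A.IsClosed) : pKer A = (pRan (A†))ᗮ := by
  ext y
  rw [Submodule.mem_orthogonal']
  constructor
  · rintro hy _ ⟨v, rfl⟩
    obtain ⟨hy, h0⟩ := mem_pKer_iff.1 hy
    have := LinearPMap.adjoint_isFormalAdjoint hA v ⟨y, hy⟩
    rw [h0, inner_zero_right, real_inner_comm] at this
    exact this
  · intro h
    rw [mem_pKer_iff_mem_graph]
    let e : (E × F) ≃ₗ[ℝ] WithLp 2 (E × F) := (WithLp.linearEquiv 2 ℝ (E × F)).symm
    let G : Submodule ℝ (WithLp 2 (E × F)) := A.graph.map e.toLinearMap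
    have hG : _root_.IsClosed (G : Set (WithLp 2 (E × F))) := by
      simp only [G, Submodule.map_coe, LinearEquiv.coe_coe, LinearEquiv.image_eq_preimage_symm]
      exact hc.preimage (WithLp.prod_continuous_ofLp _ _ _)
    have : CompleteSpace G := hG.completeSpace_coe
    suffices hy : e (y, 0) ∈ Gᗮᗮ by
      rw [Submodule.orthogonal_orthogonal] at hy
      obtain ⟨z, hz, hzy⟩ := hy
      exact e.injective hzy ▸ hz
    rw [Submodule.mem_orthogonal]
    intro w hw
    have hadj : ∀ x : A.domain, ⟪-w.fst, (x : E)⟫ = ⟪w.snd, A x⟫ := fun x => by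
      have := (Submodule.mem_orthogonal' _ _).1 hw (e (x, A x)) ⟨_, A.mem_graph x, rfl⟩
      simp only [WithLp.prod_inner_apply] at this
      rw [inner_neg_left]
      exact neg_eq_of_add_eq_zero_right this
    have hd := LinearPMap.mem_adjoint_domain_of_exists w.snd ⟨_, hadj⟩
    have hy : ⟪y, -w.fst⟫ = 0 :=
      h _ ⟨⟨w.snd, hd⟩, LinearPMap.adjoint_apply_eq hA ⟨w.snd, hd⟩ hadj⟩
    rw [inner_neg_right, neg_eq_zero, real_inner_comm] at hy
    simpa [WithLp.prod_inner_apply, e] using hy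

end KernelRange

/-- For densely defined closed operators `A₀, A₁` with `R(A₀) ⊆ N(A₁)` and
`K = N(A₁) ∩ N(A₀†)`, the intersection domain `D = D(A₁) ∩ D(A₀†)` decomposes orthogonally as
`D = (D(A₀†) ∩ closure R(A₀)) ⊕ K ⊕ (D(A₁) ∩ closure R(A₁†))`: every `x ∈ D` splits as
`x = a⋆ + κ + a` with `A₁ x = A₁ a` and `A₀† x = A₀† a⋆`, and conversely every such sum
belongs to `D`. -/
theorem statement6 (A₀ : H₀ →ₗ.[ℝ] H₁) (A₁ : H₁ →ₗ.[ℝ] H₂)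
    (hdense₀ : Dense (A₀.domain : Set H₀)) (hdense₁ : Dense (A₁.domain : Set H₁))
    (hclosed₀ : A₀.IsClosed) (hclosed₁ : A₁.IsClosed)
    (hcomplex : pRan A₀ ≤ pKer A₁) :
    -- every `x ∈ D(A₁) ∩ D(A₀†)` splits
    (∀ (x : H₁) (hx₁ : x ∈ A₁.domain) (hx₀ : x ∈ (A₀†).domain),
      ∃ (astar κ a : H₁) (hastar : astar ∈ (A₀†).domain) (ha : a ∈ A₁.domain),
        astar ∈ (pRan A₀).topologicalClosure
        ∧ κ ∈ pKer A₁ ⊓ pKer (A₀†)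
        ∧ a ∈ (pRan (A₁†)).topologicalClosure
        ∧ x = astar + κ + a
        ∧ A₁ ⟨x, hx₁⟩ = A₁ ⟨a, ha⟩
        ∧ A₀† ⟨x, hx₀⟩ = A₀† ⟨astar, hastar⟩)
    -- the three summands are mutually orthogonal
    ∧ ((pRan A₀).topologicalClosure ≤ (pKer A₁ ⊓ pKer (A₀†))ᗮ)
    ∧ ((pRan A₀).topologicalClosure ≤ ((pRan (A₁†)).topologicalClosure)ᗮ)
    ∧ ((pKer A₁ ⊓ pKer (A₀†)) ≤ ((pRan (A₁†)).topologicalClosure)ᗮ)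
    -- conversely, any such sum lies in `D(A₁) ∩ D(A₀†)`
    ∧ (∀ astar κ a : H₁, astar ∈ (A₀†).domain → astar ∈ (pRan A₀).topologicalClosure →
        κ ∈ pKer A₁ ⊓ pKer (A₀†) → a ∈ A₁.domain → a ∈ (pRan (A₁†)).topologicalClosure →
        astar + κ + a ∈ A₁.domain ∧ astar + κ + a ∈ (A₀†).domain) := by
  have hK₀ := pKer_adjoint hdense₀
  have hK₁ := pKer_eq_orthogonal_pRan_adjoint hdense₁ hclosed₁
  have hK₀' : pKer (A₀†) = (pRan A₀).topologicalClosureᗮ := by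
    rw [hK₀, Submodule.orthogonal_closure]
  have hK₁' : pKer A₁ = (pRan (A₁†)).topologicalClosureᗮ := by
    rw [hK₁, Submodule.orthogonal_closure]
  have hran₀ : (pRan A₀).topologicalClosure ≤ pKer A₁ :=
    Submodule.topologicalClosure_minimal _ hcomplex (hK₁ ▸ Submodule.isClosed_orthogonal _)
  have hran₁ : (pRan (A₁†)).topologicalClosure ≤ pKer (A₀†) := by
    rw [hK₀', Submodule.le_orthogonal_iff_le_orthogonal, ← hK₁']
    exact hran₀
  refine ⟨fun x hx₁ hx₀ => ?_, ?_, hK₁' ▸ hran₀, hK₁' ▸ inf_le_left, ?_⟩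
  · have : CompleteSpace (pRan A₀).topologicalClosure :=
      (Submodule.isClosed_topologicalClosure _).completeSpace_coe
    have : CompleteSpace (pRan (A₁†)).topologicalClosure :=
      (Submodule.isClosed_topologicalClosure _).completeSpace_coe
    set p := (pRan A₀).topologicalClosure.starProjection x
    set q := (pRan (A₁†)).topologicalClosure.starProjection x
    have hp : p ∈ (pRan A₀).topologicalClosure := Submodule.starProjection_apply_mem _ x
    have hq : q ∈ (pRan (A₁†)).topologicalClosure := Submodule.starProjection_apply_mem _ x
    have hxp : x - p ∈ pKer (A₀†) := hK₀' ▸ Submodule.sub_starProjection_mem_orthogonal x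
    have hxq : x - q ∈ pKer A₁ := hK₁' ▸ Submodule.sub_starProjection_mem_orthogonal x
    obtain ⟨hpd, hpe⟩ := exists_map_eq_of_sub_mem_pKer hx₀ hxp
    obtain ⟨hqd, hqe⟩ := exists_map_eq_of_sub_mem_pKer hx₁ hxq
    refine ⟨p, x - p - q, q, hpd, hqd, hp, ⟨?_, sub_mem hxp (hran₁ hq)⟩, hq, by abel, hqe, hpe⟩
    rw [sub_right_comm]
    exact sub_mem hxq (hran₀ hp)
  · exact (Submodule.le_orthogonal_orthogonal _).trans
      (Submodule.orthogonal_le (hK₀' ▸ inf_le_right))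
  · intro p κ q hpd hp hκ hqd hq
    obtain ⟨hκ₁, -⟩ := mem_pKer_iff.1 hκ.1
    obtain ⟨hκ₀, -⟩ := mem_pKer_iff.1 hκ.2
    obtain ⟨hp₁, -⟩ := mem_pKer_iff.1 (hran₀ hp)
    obtain ⟨hq₀, -⟩ := mem_pKer_iff.1 (hran₁ hq)
    exact ⟨add_mem (add_mem hp₁ hκ₁) hqd, add_mem (add_mem hpd hκ₀) hq₀⟩
end
end

section
/- Let A₂ : D(A₂) ⊆ H₂ → H₃ be a densely defined closed linear operator with closed range, and let f ∈ R(A₂). Then there exists a unique y_f ∈ D(A₂*) ∩ R(A₂) such that ⟨A₂*y_f, A₂*φ⟩_{H₂} = ⟨f, φ⟩_{H₃} for all φ ∈ D(A₂*) ∩ R(A₂); moreover this variational identity then holds for all φ ∈ D(A₂*), the element A₂*y_f belongs to D(A₂) ∩ R(A₂*) with A₂A₂*y_f = f, and A₂*y_f equals the unique element x_f of D(A₂) ∩ R(A₂*) satisfying A₂x_f = f. -/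
open Submodule LinearPMap RealInnerProductSpace

noncomputable section

variable {H₁ H₂ H₃ : Type*}
  [NormedAddCommGroup H₁] [InnerProductSpace ℝ H₁] [CompleteSpace H₁]
  [NormedAddCommGroup H₂] [InnerProductSpace ℝ H₂] [CompleteSpace H₂]
  [NormedAddCommGroup H₃] [InnerProductSpace ℝ H₃] [CompleteSpace H₃]

theorem mem_pRan {E F : Type*} [AddCommGroup E] [Module ℝ E] [AddCommGroup F] [Module ℝ F]
    {A : E →ₗ.[ℝ] F} {y : F} : y ∈ pRan A ↔ ∃ x : A.domain, A x = y :=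
  Iff.rfl

theorem mem_pKer {E F : Type*} [AddCommGroup E] [Module ℝ E] [AddCommGroup F] [Module ℝ F]
    {A : E →ₗ.[ℝ] F} {x : E} : x ∈ pKer A ↔ ∃ hx : x ∈ A.domain, A ⟨x, hx⟩ = 0 := by
  constructor
  · rintro ⟨⟨x, hx⟩, h, rfl⟩
    exact ⟨hx, h⟩
  · rintro ⟨hx, h⟩
    exact ⟨⟨x, hx⟩, h, rfl⟩

/-- The kernel of a closed operator is closed. -/
theorem isClosed_pKer {E F : Type*}
    [NormedAddCommGroup E] [InnerProductSpace ℝ E]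
    [NormedAddCommGroup F] [InnerProductSpace ℝ F]
    {A : E →ₗ.[ℝ] F} (hA : A.IsClosed) :
    IsClosed (pKer A : Set E) := by
  have h : (pKer A : Set E) = (fun x : E => (x, (0 : F))) ⁻¹' (A.graph : Set (E × F)) := by
    ext x
    simp only [SetLike.mem_coe, mem_pKer, Set.mem_preimage, LinearPMap.mem_graph_iff]
    constructor
    · rintro ⟨hx, h⟩
      exact ⟨⟨x, hx⟩, rfl, h⟩
    · rintro ⟨⟨x, hx⟩, rfl, h⟩
      exact ⟨hx, h⟩
  rw [h]
  exact IsClosed.preimage (by fun_prop) hA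

/-- Elements of a closed range have preimages of controlled norm. -/
theorem exists_preimage_norm_le_of_isClosed_pRan {A : H₂ →ₗ.[ℝ] H₃} (hA : A.IsClosed)
    (hran : IsClosed (pRan A : Set H₃)) :
    ∃ C > 0, ∀ g ∈ pRan A, ∃ x : A.domain, A x = g ∧ ‖(x : H₂)‖ ≤ C * ‖g‖ := by
  have : CompleteSpace A.graph := _root_.IsClosed.completeSpace_coe (hs := hA)
  have : CompleteSpace (pRan A) := hran.completeSpace_coe
  let T : A.graph →L[ℝ] pRan A :=
    ((ContinuousLinearMap.snd ℝ H₂ H₃).comp A.graph.subtypeL).codRestrict (pRan A) fun p => by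
      obtain ⟨x, -, hx⟩ := (LinearPMap.mem_graph_iff A).1 p.2
      exact ⟨x, hx⟩
  have hT : Function.Surjective T := by
    rintro ⟨_, x, rfl⟩
    exact ⟨⟨_, A.mem_graph x⟩, rfl⟩
  obtain ⟨C, hC, h⟩ := T.exists_preimage_norm_le hT
  refine ⟨C, hC, fun g hg => ?_⟩
  obtain ⟨p, hp, hle⟩ := h ⟨g, hg⟩
  obtain ⟨x, hx₁, hx₂⟩ := (LinearPMap.mem_graph_iff A).1 p.2
  refine ⟨x, hx₂.trans (congrArg Subtype.val hp), ?_⟩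
  rw [hx₁]
  exact (norm_fst_le (p : H₂ × H₃)).trans hle

/-- The closed range theorem: the adjoint maps `D(A†) ∩ R(A)` onto `N(A)ᗮ`. -/
theorem exists_adjoint_apply_eq_of_mem_orthogonal_pKer {A : H₂ →ₗ.[ℝ] H₃}
    (hdense : Dense (A.domain : Set H₂)) (hA : A.IsClosed) (hran : IsClosed (pRan A : Set H₃))
    {w : H₂} (hw : w ∈ (pKer A)ᗮ) :
    ∃ y : (A†).domain, (y : H₃) ∈ pRan A ∧ A† y = w := by
  have : CompleteSpace (pRan A) := hran.completeSpace_coe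
  obtain ⟨C, -, hC⟩ := exists_preimage_norm_le_of_isClosed_pRan hA hran
  obtain ⟨s, hs⟩ := A.toFun.rangeRestrict.exists_rightInverse_of_surjective
    A.toFun.range_rangeRestrict
  have hs' (g : pRan A) : A (s g) = g := congrArg Subtype.val (LinearMap.congr_fun hs g)
  have key (x z : A.domain) (h : A x = A z) : ⟪w, (x : H₂)⟫ = ⟪w, (z : H₂)⟫ := by
    rw [← sub_eq_zero, ← inner_sub_right]
    refine (Submodule.mem_orthogonal' _ _).1 hw _ (mem_pKer.2 ⟨(x - z).2, ?_⟩)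
    exact (A.map_sub x z).trans (sub_eq_zero.2 h)
  let l : StrongDual ℝ (pRan A) :=
    ((innerₛₗ ℝ w).comp (A.domain.subtype.comp s)).mkContinuous (‖w‖ * C) fun g => by
      obtain ⟨x, hx, hle⟩ := hC g g.2
      change ‖⟪w, (s g : H₂)⟫‖ ≤ _
      rw [key (s g) x ((hs' g).trans hx.symm), mul_assoc]
      exact (norm_inner_le_norm w (x : H₂)).trans
        (mul_le_mul_of_nonneg_left hle (norm_nonneg w))
  let y : pRan A := (InnerProductSpace.toDual ℝ (pRan A)).symm l
  have hy (x : A.domain) : ⟪w, (x : H₂)⟫ = ⟪(y : H₃), A x⟫ := by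
    have h : ⟪y, (⟨A x, x, rfl⟩ : pRan A)⟫ = l ⟨A x, x, rfl⟩ :=
      InnerProductSpace.toDual_symm_apply
    exact (key x _ (hs' ⟨A x, x, rfl⟩).symm).trans h.symm
  have hyd := LinearPMap.mem_adjoint_domain_of_exists (y : H₃) ⟨w, hy⟩
  exact ⟨⟨y, hyd⟩, y.2, LinearPMap.adjoint_apply_eq hdense ⟨y, hyd⟩ hy⟩

/-- For an operator with closed kernel, every element of the range has a preimage orthogonal to
the kernel. -/
theorem exists_apply_eq_mem_orthogonal_pKer {E F : Type*}
    [NormedAddCommGroup E] [InnerProductSpace ℝ E] [CompleteSpace E]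
    [NormedAddCommGroup F] [InnerProductSpace ℝ F]
    {A : E →ₗ.[ℝ] F}
    (hker : IsClosed (pKer A : Set E)) {f : F} (hf : f ∈ pRan A) :
    ∃ x : A.domain, A x = f ∧ (x : E) ∈ (pKer A)ᗮ := by
  have : CompleteSpace (pKer A) := hker.completeSpace_coe
  obtain ⟨x, rfl⟩ := mem_pRan.1 hf
  obtain ⟨hp, hp₀⟩ := mem_pKer.1 ((pKer A).starProjection_apply_mem (x : E))
  refine ⟨x - ⟨_, hp⟩, ?_, (pKer A).sub_starProjection_mem_orthogonal (x : E)⟩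
  rw [A.map_sub, hp₀, sub_zero]

theorem eq_zero_of_adjoint_apply_eq_zero {E F : Type*}
    [NormedAddCommGroup E] [InnerProductSpace ℝ E] [CompleteSpace E]
    [NormedAddCommGroup F] [InnerProductSpace ℝ F]
    {A : E →ₗ.[ℝ] F}
    (hdense : Dense (A.domain : Set E)) {y : (A†).domain} (hy : (y : F) ∈ pRan A)
    (h : A† y = 0) : y = 0 := by
  obtain ⟨x, hx⟩ := mem_pRan.1 hy
  have := LinearPMap.adjoint_isFormalAdjoint hdense y x
  rw [h, inner_zero_left, hx] at this
  exact Subtype.ext (inner_self_eq_zero.1 this.symm)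

theorem eq_zero_of_mem_pRan_adjoint_of_apply_eq_zero {E F : Type*}
    [NormedAddCommGroup E] [InnerProductSpace ℝ E] [CompleteSpace E]
    [NormedAddCommGroup F] [InnerProductSpace ℝ F]
    {A : E →ₗ.[ℝ] F}
    (hdense : Dense (A.domain : Set E)) {x : A.domain} (hx : (x : E) ∈ pRan (A†))
    (h : A x = 0) : x = 0 := by
  obtain ⟨y, hy⟩ := mem_pRan.1 hx
  have := LinearPMap.adjoint_isFormalAdjoint hdense y x
  rw [h, inner_zero_right, hy] at this
  exact Subtype.ext (inner_self_eq_zero.1 this)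

/-- Variational formulation: for a densely defined closed operator
`A₂ : D(A₂) ⊆ H₂ → H₃` with closed range and `f ∈ R(A₂)`, there is a unique
`y_f ∈ D(A₂†) ∩ R(A₂)` with `⟪A₂† y_f, A₂† φ⟫ = ⟪f, φ⟫` for all `φ ∈ D(A₂†) ∩ R(A₂)`; the
identity then holds for all `φ ∈ D(A₂†)`, `A₂† y_f ∈ D(A₂) ∩ R(A₂†)` with `A₂ A₂† y_f = f`,
and `A₂† y_f` is the unique element `x_f` of `D(A₂) ∩ R(A₂†)` with `A₂ x_f = f`. -/
theorem statement9 (A₂ : H₂ →ₗ.[ℝ] H₃)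
    (hdense : Dense (A₂.domain : Set H₂)) (hclosed : A₂.IsClosed)
    (hrange : IsClosed (pRan A₂ : Set H₃))
    (f : H₃) (hf : f ∈ pRan A₂) :
    ∃ (yf : H₃) (hyfd : yf ∈ (A₂†).domain),
      yf ∈ pRan A₂
      -- the variational identity on `D(A₂†) ∩ R(A₂)`
      ∧ (∀ (φ : H₃) (hφ : φ ∈ (A₂†).domain), φ ∈ pRan A₂ →
          ⟪A₂† ⟨yf, hyfd⟩, A₂† ⟨φ, hφ⟩⟫ = ⟪f, φ⟫)
      -- uniqueness of `y_f` in `D(A₂†) ∩ R(A₂)`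
      ∧ (∀ (y' : H₃) (hy'd : y' ∈ (A₂†).domain), y' ∈ pRan A₂ →
          (∀ (φ : H₃) (hφ : φ ∈ (A₂†).domain), φ ∈ pRan A₂ →
            ⟪A₂† ⟨y', hy'd⟩, A₂† ⟨φ, hφ⟩⟫ = ⟪f, φ⟫) → y' = yf)
      -- the variational identity extends to all of `D(A₂†)`
      ∧ (∀ (φ : H₃) (hφ : φ ∈ (A₂†).domain),
          ⟪A₂† ⟨yf, hyfd⟩, A₂† ⟨φ, hφ⟩⟫ = ⟪f, φ⟫)
      -- `A₂† y_f ∈ D(A₂) ∩ R(A₂†)` with `A₂ A₂† y_f = f`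
      ∧ ∃ hmem : A₂† ⟨yf, hyfd⟩ ∈ A₂.domain,
          A₂† ⟨yf, hyfd⟩ ∈ pRan (A₂†)
          ∧ A₂ ⟨A₂† ⟨yf, hyfd⟩, hmem⟩ = f
          -- `A₂† y_f` is the unique element of `D(A₂) ∩ R(A₂†)` mapped to `f` by `A₂`
          ∧ (∀ (xf : H₂) (hxf : xf ∈ A₂.domain), xf ∈ pRan (A₂†) →
              A₂ ⟨xf, hxf⟩ = f → xf = A₂† ⟨yf, hyfd⟩) := by
  obtain ⟨x, rfl, hx⟩ := exists_apply_eq_mem_orthogonal_pKer (isClosed_pKer hclosed) hf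
  obtain ⟨⟨y, hyd⟩, hyr, hy⟩ :=
    exists_adjoint_apply_eq_of_mem_orthogonal_pKer hdense hclosed hrange hx
  have hvar (φ : H₃) (hφ : φ ∈ (A₂†).domain) :
      ⟪A₂† ⟨y, hyd⟩, A₂† ⟨φ, hφ⟩⟫ = ⟪A₂ x, φ⟫ := by
    rw [hy]
    exact (LinearPMap.adjoint_isFormalAdjoint hdense).symm x ⟨φ, hφ⟩ |>.symm
  have hxr : (x : H₂) ∈ pRan (A₂†) := ⟨⟨y, hyd⟩, hy⟩
  refine ⟨y, hyd, hyr, fun φ hφ _ => hvar φ hφ, fun y' hyd' hyr' h => ?_, hvar, ?_⟩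
  · let d : (A₂†).domain := ⟨y', hyd'⟩ - ⟨y, hyd⟩
    have hdr : (d : H₃) ∈ pRan A₂ := sub_mem hyr' hyr
    have hd : A₂† d = 0 := by
      have hAd : A₂† d = A₂† ⟨y', hyd'⟩ - A₂† ⟨y, hyd⟩ := (A₂†).map_sub _ _
      refine inner_self_eq_zero (𝕜 := ℝ).1 ?_
      nth_rewrite 1 [hAd]
      rw [inner_sub_left, h d d.2 hdr, hvar d d.2, sub_self]
    exact congrArg Subtype.val (sub_eq_zero.1 (eq_zero_of_adjoint_apply_eq_zero hdense hdr hd))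
  · rw [hy]
    refine ⟨x.2, hxr, rfl, fun x' hxd' hxr' h => ?_⟩
    have hd : A₂ (⟨x', hxd'⟩ - x) = 0 := by rw [A₂.map_sub, h, sub_self]
    exact congrArg Subtype.val (sub_eq_zero.1
      (eq_zero_of_mem_pRan_adjoint_of_apply_eq_zero hdense (sub_mem hxr' hxr) hd))
end
end
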